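/- Let h,w ≥ 2, n = hw, and let W be the {0,1} incidence matrix of edges versus tiles of the Sudoku graph G_{hw}. Then rank(W) = n³ − (n−1)³ + (n−1)(h−1)(w−1). -/

import Mathlib

open Matrix Finset

/-- The (0-indexed) box containing cell `(i,j)` in a Sudoku grid of type `(h,w)`. -/
def box0 (h w : ℕ) (i j : Fin (h * w)) : Fin (h * w) :=
  ⟨h * ((i : ℕ) / h) + (j : ℕ) / w, by
    have hh : 0 < h := by
      rcases Nat.eq_zero_or_pos h with h0 | h0
      · exact absurd i.2 (by simp [h0])
      · exact h0
    have hw : 0 < w := by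
      rcases Nat.eq_zero_or_pos w with h0 | h0
      · exact absurd i.2 (by simp [h0, Nat.mul_zero])
      · exact h0
    have h1 : (i : ℕ) / h < w := Nat.div_lt_of_lt_mul i.2
    have h2 : (j : ℕ) / w < h := Nat.div_lt_of_lt_mul (lt_of_lt_of_eq j.2 (Nat.mul_comm h w))
    calc h * ((i : ℕ) / h) + (j : ℕ) / w < h * ((i : ℕ) / h) + h := by omega
      _ = h * ((i : ℕ) / h + 1) := by ring
      _ ≤ h * w := Nat.mul_le_mul_left h h1⟩

/-- Edges of the Sudoku graph `G_{hw}`: row-column, row-symbol, column-symbol,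
and box-symbol pairs (in this order). -/
abbrev SEdge (h w : ℕ) :=
  (Fin (h * w) × Fin (h * w)) ⊕ (Fin (h * w) × Fin (h * w)) ⊕
  (Fin (h * w) × Fin (h * w)) ⊕ (Fin (h * w) × Fin (h * w))

/-- The `{0,1}` incidence matrix of edges versus tiles of `G_{hw}`; a tile is
indexed by `(i,j,k)` (row, column, symbol) and consists of the four edges
`r_i c_j, r_i s_k, c_j s_k, b_ℓ s_k` where `ℓ = box0 h w i j`. -/
def Wmat (h w : ℕ) : Matrix (SEdge h w) (Fin (h * w) × Fin (h * w) × Fin (h * w)) ℝ :=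
  fun e t => match e with
  | Sum.inl (i, j) => if t.1 = i ∧ t.2.1 = j then 1 else 0
  | Sum.inr (Sum.inl (i, k)) => if t.1 = i ∧ t.2.2 = k then 1 else 0
  | Sum.inr (Sum.inr (Sum.inl (j, k))) => if t.2.1 = j ∧ t.2.2 = k then 1 else 0
  | Sum.inr (Sum.inr (Sum.inr (l, k))) => if box0 h w t.1 t.2.1 = l ∧ t.2.2 = k then 1 else 0

/-- The horizontal band of boxes containing row `i`. -/
def rowBand (h w : ℕ) (i : Fin (h * w)) : Fin w :=
  ⟨(i : ℕ) / h, Nat.div_lt_of_lt_mul i.2⟩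

/-- The vertical stack of boxes containing column `j`. -/
def colStack (h w : ℕ) (j : Fin (h * w)) : Fin h :=
  ⟨(j : ℕ) / w, Nat.div_lt_of_lt_mul (lt_of_lt_of_eq j.2 (Nat.mul_comm h w))⟩

/-- The box in band `p.1` and stack `p.2`. -/
def boxEquiv (h w : ℕ) : Fin w × Fin h ≃ Fin (h * w) :=
  finProdFinEquiv.trans (finCongr (Nat.mul_comm w h))

theorem box0_eq_boxEquiv (h w : ℕ) (i j : Fin (h * w)) :
    box0 h w i j = boxEquiv h w (rowBand h w i, colStack h w j) := by
  ext
  simp [box0, boxEquiv, rowBand, colStack, add_comm]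

theorem rowBand_surjective (h w : ℕ) (hh : 0 < h) : Function.Surjective (rowBand h w) := by
  intro b
  refine ⟨⟨h * b, Nat.mul_lt_mul_of_pos_left b.2 hh⟩, ?_⟩
  ext
  simp [rowBand, hh]

theorem colStack_surjective (h w : ℕ) (hw : 0 < w) : Function.Surjective (colStack h w) := by
  intro c
  refine ⟨⟨c * w, Nat.mul_lt_mul_of_pos_right c.2 hw⟩, ?_⟩
  ext
  simp [colStack, hw]

/-- If a submodule contains the sum of a family and all but one of its members, it contains
every member. -/
theorem Submodule.mem_of_sum_mem_of_forall_ne {ι R M : Type*} [Fintype ι] [DecidableEq ι] [Ring R]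
    [AddCommGroup M] [Module R M] (S : Submodule R M) (f : ι → M) (a : ι)
    (hsum : ∑ x, f x ∈ S) (hne : ∀ x, x ≠ a → f x ∈ S) (x : ι) : f x ∈ S := by
  by_cases hx : x = a
  · subst hx
    rw [← Finset.add_sum_erase _ _ (Finset.mem_univ x)] at hsum
    exact (S.add_mem_iff_left (S.sum_mem fun y hy => hne y (Finset.ne_of_mem_erase hy))).1 hsum
  · exact hne x hx

section Rows

variable (h w : ℕ)

theorem sum_row_symbol (i : Fin (h * w)) :
    ∑ k, (Wmat h w).row (.inr (.inl (i, k))) = ∑ j, (Wmat h w).row (.inl (i, j)) := by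
  ext t
  simp [Finset.sum_apply, Matrix.row_apply, Wmat, ite_and]

theorem sum_col_symbol (j : Fin (h * w)) :
    ∑ k, (Wmat h w).row (.inr (.inr (.inl (j, k)))) = ∑ i, (Wmat h w).row (.inl (i, j)) := by
  ext t
  simp [Finset.sum_apply, Matrix.row_apply, Wmat, ite_and]

theorem sum_col_symbol_eq_sum_row_symbol (k : Fin (h * w)) :
    ∑ j, (Wmat h w).row (.inr (.inr (.inl (j, k)))) = ∑ i, (Wmat h w).row (.inr (.inl (i, k))) := by
  ext t
  simp [Finset.sum_apply, Matrix.row_apply, Wmat, ite_and]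

theorem sum_stack_box_symbol (b : Fin w) (k : Fin (h * w)) :
    ∑ c, (Wmat h w).row (.inr (.inr (.inr (boxEquiv h w (b, c), k)))) =
      ∑ i with rowBand h w i = b, (Wmat h w).row (.inr (.inl (i, k))) := by
  ext t
  simp [Finset.sum_apply, Matrix.row_apply, Wmat, ite_and, box0_eq_boxEquiv]

theorem sum_band_box_symbol (c : Fin h) (k : Fin (h * w)) :
    ∑ b, (Wmat h w).row (.inr (.inr (.inr (boxEquiv h w (b, c), k)))) =
      ∑ j with colStack h w j = c, (Wmat h w).row (.inr (.inr (.inl (j, k)))) := by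
  ext t
  simp [Finset.sum_apply, Matrix.row_apply, Wmat, ite_and, box0_eq_boxEquiv]

theorem sum_symbol_box_symbol (l : Fin (h * w)) :
    ∑ k, (Wmat h w).row (.inr (.inr (.inr (l, k)))) =
      ∑ p : Fin (h * w) × Fin (h * w) with box0 h w p.1 p.2 = l, (Wmat h w).row (.inl p) := by
  ext t
  have hcell : ∀ p, Wmat h w (.inl p) t = if (t.1, t.2.1) = p then 1 else 0 := by
    rintro ⟨i, j⟩
    simp [Wmat]
  simp only [Finset.sum_apply, Matrix.row_apply, hcell]
  simp [Wmat, ite_and]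

theorem sum_smul_Wmat_apply (g : SEdge h w → ℝ) (i j k : Fin (h * w)) :
    (∑ e, g e • (Wmat h w).row e) (i, j, k) =
      g (.inl (i, j)) + (g (.inr (.inl (i, k))) + (g (.inr (.inr (.inl (j, k)))) +
        g (.inr (.inr (.inr (box0 h w i j, k)))))) := by
  simp [Finset.sum_apply, Matrix.row_apply, Fintype.sum_prod_type, Wmat, ite_and]

/-- Edges whose rows form a basis of the row space of `Wmat h w`: every edge avoiding a fixed
symbol `z` (for edges at a symbol), a fixed column `z` (for column-symbol edges), and a fixed band
`b₀` and stack `c₀` (for box-symbol edges). -/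
def basisEdges (z : Fin (h * w)) (b₀ : Fin w) (c₀ : Fin h) : Finset (SEdge h w) :=
  univ.disjSum ((univ ×ˢ univ.erase z).disjSum ((univ.erase z ×ˢ univ.erase z).disjSum
    (((univ.erase b₀ ×ˢ univ.erase c₀).map (boxEquiv h w).toEmbedding) ×ˢ univ.erase z)))

theorem card_basisEdges (z : Fin (h * w)) (b₀ : Fin w) (c₀ : Fin h) :
    (basisEdges h w z b₀ c₀).card = (h * w) * (h * w) + ((h * w) * (h * w - 1) +
      ((h * w - 1) * (h * w - 1) + (w - 1) * (h - 1) * (h * w - 1))) := by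
  simp [basisEdges]

theorem linearIndepOn_basisEdges (z : Fin (h * w)) (hh : 0 < h) (hw : 0 < w) :
    LinearIndepOn ℝ ((Wmat h w).row)
      (basisEdges h w z (rowBand h w z) (colStack h w z) : Set (SEdge h w)) := by
  rw [linearIndepOn_finset_iff]
  intro f hf
  set T := basisEdges h w z (rowBand h w z) (colStack h w z) with hT
  obtain ⟨g, hg⟩ : ∃ g : SEdge h w → ℝ, g = fun e => if e ∈ T then f e else 0 := ⟨_, rfl⟩
  have hsum : ∑ e, g e • (Wmat h w).row e = 0 := by
    rw [← hf]
    simp [hg, ite_smul, Finset.sum_ite_mem]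
  have hzero : ∀ i j k, g (.inl (i, j)) + (g (.inr (.inl (i, k))) +
      (g (.inr (.inr (.inl (j, k)))) + g (.inr (.inr (.inr (box0 h w i j, k)))))) = 0 := by
    intro i j k
    rw [← sum_smul_Wmat_apply, hsum]
    rfl
  have hBz : ∀ i, g (.inr (.inl (i, z))) = 0 := by simp [hg, hT, basisEdges]
  have hCsym : ∀ j, g (.inr (.inr (.inl (j, z)))) = 0 := by simp [hg, hT, basisEdges]
  have hCcol : ∀ k, g (.inr (.inr (.inl (z, k)))) = 0 := by simp [hg, hT, basisEdges]
  have hDsym : ∀ l, g (.inr (.inr (.inr (l, z)))) = 0 := by simp [hg, hT, basisEdges]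
  have hDcol : ∀ i k, g (.inr (.inr (.inr (box0 h w i z, k)))) = 0 := by
    simp [hg, hT, basisEdges, box0_eq_boxEquiv]
  have hDrow : ∀ j k, g (.inr (.inr (.inr (box0 h w z j, k)))) = 0 := by
    simp [hg, hT, basisEdges, box0_eq_boxEquiv]
  have hA : ∀ i j, g (.inl (i, j)) = 0 := fun i j => by
    simpa [hBz, hCsym, hDsym] using hzero i j z
  have hB : ∀ i k, g (.inr (.inl (i, k))) = 0 := fun i k => by
    simpa [hA, hCcol, hDcol] using hzero i z k
  have hC : ∀ j k, g (.inr (.inr (.inl (j, k)))) = 0 := fun j k => by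
    simpa [hA, hB, hDrow] using hzero z j k
  have hD : ∀ l k, g (.inr (.inr (.inr (l, k)))) = 0 := fun l k => by
    obtain ⟨⟨b, c⟩, rfl⟩ := (boxEquiv h w).surjective l
    obtain ⟨i, rfl⟩ := rowBand_surjective h w hh b
    obtain ⟨j, rfl⟩ := colStack_surjective h w hw c
    simpa [hA, hB, hC, box0_eq_boxEquiv] using hzero i j k
  intro e he
  have hge : g e = f e := by simp [hg, he]
  rw [← hge]
  rcases e with ⟨i, j⟩ | ⟨i, k⟩ | ⟨j, k⟩ | ⟨l, k⟩
  exacts [hA i j, hB i k, hC j k, hD l k]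

theorem Wmat_mem_span_basisEdges (z : Fin (h * w)) (b₀ : Fin w) (c₀ : Fin h) (e : SEdge h w) :
    (Wmat h w).row e ∈ Submodule.span ℝ ((Wmat h w).row '' (basisEdges h w z b₀ c₀ : Set (SEdge h w))) := by
  set S := Submodule.span ℝ ((Wmat h w).row '' (basisEdges h w z b₀ c₀ : Set (SEdge h w)))
  have hbasis : ∀ e ∈ basisEdges h w z b₀ c₀, (Wmat h w).row e ∈ S := fun e he =>
    Submodule.subset_span ⟨e, he, rfl⟩
  have hA : ∀ p, (Wmat h w).row (.inl p) ∈ S := fun p => hbasis _ (by simp [basisEdges])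
  have hB : ∀ i k, (Wmat h w).row (.inr (.inl (i, k))) ∈ S := fun i =>
    S.mem_of_sum_mem_of_forall_ne _ z
      (by rw [sum_row_symbol]; exact S.sum_mem fun _ _ => hA _)
      fun k hk => hbasis _ (by simp [basisEdges, hk])
  have hC : ∀ j k, (Wmat h w).row (.inr (.inr (.inl (j, k)))) ∈ S := fun j =>
    S.mem_of_sum_mem_of_forall_ne _ z
      (by rw [sum_col_symbol]; exact S.sum_mem fun _ _ => hA _)
      fun k hk => S.mem_of_sum_mem_of_forall_ne
        (fun j => (Wmat h w).row (.inr (.inr (.inl (j, k))))) z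
        (by rw [sum_col_symbol_eq_sum_row_symbol]; exact S.sum_mem fun _ _ => hB _ _)
        (fun j hj => hbasis _ (by simp [basisEdges, hj, hk])) j
  have hD : ∀ l k, (Wmat h w).row (.inr (.inr (.inr (l, k)))) ∈ S := fun l =>
    S.mem_of_sum_mem_of_forall_ne _ z
      (by rw [sum_symbol_box_symbol]; exact S.sum_mem fun _ _ => hA _)
      fun k hk => by
        obtain ⟨⟨b, c⟩, rfl⟩ := (boxEquiv h w).surjective l
        refine S.mem_of_sum_mem_of_forall_ne
          (fun b => (Wmat h w).row (.inr (.inr (.inr (boxEquiv h w (b, c), k))))) b₀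
          (by rw [sum_band_box_symbol]; exact S.sum_mem fun _ _ => hC _ _) (fun b hb => ?_) b
        exact S.mem_of_sum_mem_of_forall_ne
          (fun c => (Wmat h w).row (.inr (.inr (.inr (boxEquiv h w (b, c), k))))) c₀
          (by rw [sum_stack_box_symbol]; exact S.sum_mem fun _ _ => hB _ _)
          (fun c hc => hbasis _ (by simp [basisEdges, hb, hc, hk])) c
  rcases e with p | ⟨i, k⟩ | ⟨j, k⟩ | ⟨l, k⟩
  exacts [hA p, hB i k, hC j k, hD l k]

end Rows

theorem rank_Wmat (h w : ℕ) (hh : 2 ≤ h) (hw : 2 ≤ w) :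
    (Wmat h w).rank =
      (h * w) ^ 3 - (h * w - 1) ^ 3 + (h * w - 1) * (h - 1) * (w - 1) := by
  have hh' : 0 < h := by omega
  have hw' : 0 < w := by omega
  have hn : 0 < h * w := Nat.mul_pos hh' hw'
  let z : Fin (h * w) := ⟨0, hn⟩
  let T := basisEdges h w z (rowBand h w z) (colStack h w z)
  have hspan : Submodule.span ℝ (Set.range ((Wmat h w).row)) =
      Submodule.span ℝ (Set.range fun e : T => (Wmat h w).row e) := by
    apply le_antisymm
    · rw [Submodule.span_le]
      rintro _ ⟨e, rfl⟩
      have he := Wmat_mem_span_basisEdges h w z (rowBand h w z) (colStack h w z) e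
      rwa [Set.image_eq_range] at he
    · apply Submodule.span_mono
      rintro _ ⟨e, rfl⟩
      exact ⟨e, rfl⟩
  have hrank : (Wmat h w).rank = T.card := by
    rw [Matrix.rank_eq_finrank_span_row, hspan]
    exact (finrank_span_eq_card (linearIndepOn_basisEdges h w z hh' hw')).trans (Fintype.card_coe _)
  rw [hrank, card_basisEdges]
  obtain ⟨m, hm⟩ : ∃ m, h * w = m + 1 := ⟨h * w - 1, by omega⟩
  have hcube : (m + 1) ^ 3 - m ^ 3 = 3 * m ^ 2 + 3 * m + 1 :=
    Nat.sub_eq_of_eq_add (by ring)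
  rw [hm, Nat.add_sub_cancel, hcube]
  ring
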